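/- Let k ≥ 2 and define PPT(A:B) := {σ : σ positive semidefinite, σ^{T_B} positive semidefinite, tr σ ≤ 1}. Then on ℂ^{dA} ⊗ ℂ^{dB} the inclusions PPT(A:B) ⊆ PPT_{k+1}(A:B) ⊆ PPT_k(A:B) ⊆ Rains(A:B) hold. -/

import Mathlib

open scoped Kronecker ComplexOrder Matrix

attribute [local instance] Classical.propDecidable

noncomputable section

namespace QIT

variable {n : Type*} [Fintype n] [DecidableEq n]

/-- Base-2 matrix logarithm taken on the support (junk value `0` for non-Hermitian input). -/
def matLog (A : Matrix n n ℂ) : Matrix n n ℂ :=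
  if hA : A.IsHermitian then
    (hA.eigenvectorUnitary : Matrix n n ℂ) *
      Matrix.diagonal (fun i => if hA.eigenvalues i = 0 then (0 : ℂ)
        else (Real.logb 2 (hA.eigenvalues i) : ℂ)) *
      (hA.eigenvectorUnitary : Matrix n n ℂ)ᴴ
  else 0

/-- Orthogonal projection onto the support of a Hermitian matrix. -/
def suppProj (A : Matrix n n ℂ) : Matrix n n ℂ :=
  if hA : A.IsHermitian then
    (hA.eigenvectorUnitary : Matrix n n ℂ) *
      Matrix.diagonal (fun i => if hA.eigenvalues i = 0 then (0 : ℂ) else 1) *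
      (hA.eigenvectorUnitary : Matrix n n ℂ)ᴴ
  else 0

/-- Support inclusion `supp ρ ⊆ supp σ`, phrased via kernels. -/
def suppLE (ρ σ : Matrix n n ℂ) : Prop :=
  ∀ x : n → ℂ, σ.mulVec x = 0 → ρ.mulVec x = 0

/-- Umegaki relative entropy (base 2), `+∞` when supports are not included. -/
def relEnt (ρ σ : Matrix n n ℂ) : EReal :=
  if suppLE ρ σ then (((ρ * (matLog ρ - matLog σ)).trace).re : EReal) else ⊤

/-- Classical relative-entropy summand `p log₂(p/q)` with conventions
`0 · log(0/q) = 0` and `p · log(p/0) = +∞` for `p ≠ 0`. -/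
def klTerm (p q : ℝ) : EReal :=
  if p = 0 then 0 else if q = 0 then ⊤ else ((p * Real.logb 2 (p / q) : ℝ) : EReal)

/-- A finite POVM. -/
def IsPOVM {m : ℕ} (M : Fin m → Matrix n n ℂ) : Prop :=
  (∀ x, (M x).PosSemidef) ∧ ∑ x, M x = 1

/-- Measured relative entropy (base 2). -/
def measRelEnt (ρ σ : Matrix n n ℂ) : EReal :=
  ⨆ (m : ℕ) (M : Fin m → Matrix n n ℂ) (_ : IsPOVM M),
    ∑ x, klTerm ((M x * ρ).trace).re ((M x * σ).trace).re

/-- Trace norm: sum of singular values. -/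
def traceNorm (A : Matrix n n ℂ) : ℝ :=
  ∑ i, Real.sqrt ((Matrix.posSemidef_conjTranspose_mul_self A).1.eigenvalues i)

/-- Operator (spectral) norm: largest singular value. -/
def opNorm (A : Matrix n n ℂ) : ℝ :=
  ⨆ i, Real.sqrt ((Matrix.posSemidef_conjTranspose_mul_self A).1.eigenvalues i)

/-- Partial transpose on the second tensor factor. -/
def ptB {α β : Type*} (X : Matrix (α × β) (α × β) ℂ) : Matrix (α × β) (α × β) ℂ :=
  Matrix.of fun p q => X (p.1, q.2) (q.1, p.2)

/-- Kronecker product of two bipartite matrices, reindexed to the bipartition (A×A') : (B×B'). -/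
def kron2 {α β γ δ : Type*} (X : Matrix (α × β) (α × β) ℂ) (Y : Matrix (γ × δ) (γ × δ) ℂ) :
    Matrix ((α × γ) × β × δ) ((α × γ) × β × δ) ℂ :=
  Matrix.reindex (Equiv.prodProdProdComm α β γ δ) (Equiv.prodProdProdComm α β γ δ) (X ⊗ₖ Y)

/-- The permutation unitary on `(ℂ^d)^{⊗ m}`. -/
def permMat (d m : ℕ) (π : Equiv.Perm (Fin m)) :
    Matrix (Fin m → Fin d) (Fin m → Fin d) ℂ :=
  Matrix.of fun f g => if f ∘ π = g then 1 else 0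

/-- Membership in the `PPT_k` set. -/
def memPPTk {α β : Type*} [Fintype α] [Fintype β] [DecidableEq α] [DecidableEq β]
    (k : ℕ) (X : Matrix (α × β) (α × β) ℂ) : Prop :=
  X.PosSemidef ∧ ∃ ω : ℕ → Matrix (α × β) (α × β) ℂ,
    ω 1 = X ∧ (∀ i ∈ Finset.Icc 1 k, (ω i).IsHermitian) ∧
    (∀ i ∈ Finset.Icc 1 (k - 1),
      ((ω (i + 1)) - ptB (ω i)).PosSemidef ∧ ((ω (i + 1)) + ptB (ω i)).PosSemidef) ∧
    traceNorm (ptB (ω k)) ≤ 1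

/-- Membership in the Rains set. -/
def memRains {α β : Type*} [Fintype α] [Fintype β] [DecidableEq α] [DecidableEq β]
    (σ : Matrix (α × β) (α × β) ℂ) : Prop :=
  σ.PosSemidef ∧ traceNorm (ptB σ) ≤ 1


/-- Membership in the PPT set (subnormalized PPT states). -/
def memPPT {α β : Type*} [Fintype α] [DecidableEq α] [Fintype β] [DecidableEq β]
    (σ : Matrix (α × β) (α × β) ℂ) : Prop :=
  σ.PosSemidef ∧ (ptB σ).PosSemidef ∧ σ.trace.re ≤ 1

open Polynomial in
/-- The trace norm of a Hermitian matrix is the sum of the absolute values of its eigenvalues. -/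
theorem traceNorm_eq_sum_abs_eigenvalues {A : Matrix n n ℂ} (hA : A.IsHermitian) :
    traceNorm A = ∑ i, |hA.eigenvalues i| := by
  have hsq : Aᴴ * A = cfc (fun x : ℝ => x ^ 2) A := by
    rw [cfc_pow_id (R := ℝ) A 2 hA.isSelfAdjoint, hA.eq, sq]
  have hroots : (Aᴴ * A).charpoly.roots =
      Multiset.map (fun i => ((hA.eigenvalues i ^ 2 : ℝ) : ℂ)) Finset.univ.val := by
    rw [hsq, hA.charpoly_cfc_eq, Polynomial.roots_prod _ _
      (Finset.prod_ne_zero_iff.mpr fun i _ => X_sub_C_ne_zero _)]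
    simp_rw [RCLike.ofReal_eq_complex_ofReal, Polynomial.roots_X_sub_C, Multiset.bind_singleton]
  rw [(Matrix.posSemidef_conjTranspose_mul_self A).1.roots_charpoly_eq_eigenvalues] at hroots
  have h := congrArg (fun s => (Multiset.map (fun z : ℂ => √z.re) s).sum) hroots
  simpa [Function.comp_def, ← Complex.ofReal_pow, Real.sqrt_sq_eq_abs, traceNorm] using h

theorem re_trace_le_traceNorm {A : Matrix n n ℂ} (hA : A.IsHermitian) :
    A.trace.re ≤ traceNorm A := by
  rw [traceNorm_eq_sum_abs_eigenvalues hA, hA.trace_eq_sum_eigenvalues]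
  simpa using Finset.sum_le_sum fun i _ => le_abs_self (hA.eigenvalues i)

/-- If `-B ≤ A ≤ B`, then the trace norm of `A` is at most the trace of `B`. -/
theorem traceNorm_le_re_trace {A B : Matrix n n ℂ} (hA : A.IsHermitian)
    (hsub : (B - A).PosSemidef) (hadd : (B + A).PosSemidef) : traceNorm A ≤ B.trace.re := by
  set U : Matrix n n ℂ := (hA.eigenvectorUnitary : Matrix n n ℂ)
  have hUU : U * Uᴴ = 1 := Unitary.coe_mul_star_self hA.eigenvectorUnitary
  have hdiag : Uᴴ * A * U = Matrix.diagonal (RCLike.ofReal ∘ hA.eigenvalues) := by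
    rw [← hA.conjStarAlgAut_star_eigenvectorUnitary, Unitary.conjStarAlgAut_star_apply]
    rfl
  have htr : B.trace = (Uᴴ * B * U).trace := by
    rw [Matrix.trace_mul_comm, ← mul_assoc, hUU, one_mul]
  rw [traceNorm_eq_sum_abs_eigenvalues hA, htr, Matrix.trace, Complex.re_sum]
  refine Finset.sum_le_sum fun i _ => ?_
  have h₁ := (Complex.le_def.mp ((hsub.conjTranspose_mul_mul_same U).diag_nonneg (i := i))).1
  have h₂ := (Complex.le_def.mp ((hadd.conjTranspose_mul_mul_same U).diag_nonneg (i := i))).1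
  rw [mul_sub, sub_mul, hdiag] at h₁
  rw [mul_add, add_mul, hdiag] at h₂
  simp only [Matrix.sub_apply, Matrix.add_apply, Matrix.diagonal_apply_eq, Function.comp_apply,
    RCLike.ofReal_eq_complex_ofReal, Complex.sub_re, Complex.add_re, Complex.ofReal_re,
    Complex.zero_re] at h₁ h₂
  rw [Matrix.diag_apply]
  exact abs_le.mpr ⟨by linarith, by linarith⟩

section PartialTranspose

variable {α β : Type*}

theorem ptB_ptB (X : Matrix (α × β) (α × β) ℂ) : ptB (ptB X) = X := rfl

theorem isHermitian_ptB {X : Matrix (α × β) (α × β) ℂ} (hX : X.IsHermitian) :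
    (ptB X).IsHermitian :=
  Matrix.IsHermitian.ext fun p q => hX.apply (p.1, q.2) (q.1, p.2)

variable [Fintype α] [Fintype β]

theorem trace_ptB (X : Matrix (α × β) (α × β) ℂ) : (ptB X).trace = X.trace := rfl

variable [DecidableEq α] [DecidableEq β]

theorem memPPTk_of_memPPT {σ : Matrix (α × β) (α × β) ℂ} (hσ : memPPT σ) (k : ℕ) :
    memPPTk k σ := by
  obtain ⟨hpos, hpt, htr⟩ := hσ
  let ω : ℕ → Matrix (α × β) (α × β) ℂ := fun i => if Odd i then σ else ptB σ
  have hω : ∀ i, (ω i).PosSemidef := fun i => by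
    by_cases hi : Odd i <;> simpa [ω, hi]
  have hstep : ∀ i, ptB (ω i) = ω (i + 1) := fun i => by
    by_cases hi : Odd i <;> simp [ω, hi, Nat.odd_add_one, ptB_ptB]
  have htrace : ∀ i, (ω i).trace = σ.trace := fun i => by
    by_cases hi : Odd i <;> simp [ω, hi, trace_ptB]
  refine ⟨hpos, ω, by simp [ω], fun i _ => (hω i).1, fun i _ => ?_, ?_⟩
  · rw [hstep, sub_self]
    exact ⟨.zero, (hω _).add (hω _)⟩
  · rw [hstep]
    refine (traceNorm_le_re_trace (hω (k + 1)).1 ?_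
      ((hω (k + 1)).add (hω (k + 1)))).trans ?_
    · rw [sub_self]
      exact .zero
    · rwa [htrace]

theorem memPPTk_of_memPPTk_succ {k : ℕ} (hk : 1 ≤ k) {σ : Matrix (α × β) (α × β) ℂ}
    (hσ : memPPTk (k + 1) σ) : memPPTk k σ := by
  obtain ⟨hpos, ω, h_one, hherm, hstep, hnorm⟩ := hσ
  simp only [Finset.mem_Icc] at hherm hstep
  refine ⟨hpos, ω, h_one, fun i hi => hherm i ?_, fun i hi => hstep i ?_, ?_⟩
  · grind
  · grind
  · obtain ⟨hsub, hadd⟩ := hstep k (by omega)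
    calc traceNorm (ptB (ω k)) ≤ (ω (k + 1)).trace.re :=
          traceNorm_le_re_trace (isHermitian_ptB (hherm k (by omega))) hsub hadd
      _ = (ptB (ω (k + 1))).trace.re := by rw [trace_ptB]
      _ ≤ traceNorm (ptB (ω (k + 1))) :=
          re_trace_le_traceNorm (isHermitian_ptB (hherm (k + 1) (by omega)))
      _ ≤ 1 := hnorm

theorem memRains_of_memPPTk {k : ℕ} (hk : 1 ≤ k) {σ : Matrix (α × β) (α × β) ℂ}
    (hσ : memPPTk k σ) : memRains σ := by
  induction k, hk using Nat.le_induction with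
  | base =>
    obtain ⟨hpos, ω, h_one, -, -, hnorm⟩ := hσ
    exact ⟨hpos, h_one ▸ hnorm⟩
  | succ k hk ih => exact ih (memPPTk_of_memPPTk_succ hk hσ)

end PartialTranspose

/-- the inclusions `PPT ⊆ PPT_{k+1} ⊆ PPT_k ⊆ Rains`. -/
theorem ppt_subset_pptk_subset_rains {dA dB : ℕ} (k : ℕ) (hk : 2 ≤ k) :
    {σ : Matrix (Fin dA × Fin dB) (Fin dA × Fin dB) ℂ | memPPT σ} ⊆
        {σ : Matrix (Fin dA × Fin dB) (Fin dA × Fin dB) ℂ | memPPTk (k + 1) σ} ∧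
      {σ : Matrix (Fin dA × Fin dB) (Fin dA × Fin dB) ℂ | memPPTk (k + 1) σ} ⊆
        {σ : Matrix (Fin dA × Fin dB) (Fin dA × Fin dB) ℂ | memPPTk k σ} ∧
      {σ : Matrix (Fin dA × Fin dB) (Fin dA × Fin dB) ℂ | memPPTk k σ} ⊆
        {σ : Matrix (Fin dA × Fin dB) (Fin dA × Fin dB) ℂ | memRains σ} := by
  exact ⟨fun _ hσ => memPPTk_of_memPPT hσ (k + 1),
    fun _ hσ => memPPTk_of_memPPTk_succ (by omega) hσ,
    fun _ hσ => memRains_of_memPPTk (by omega) hσ⟩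

end QIT
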